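/- arXiv:2311.07496 — 2 statements merged into one kernel-verified Lean document; each statement's English description precedes it below -/
import Mathlib

section
/- Let a ∈ {2, 3, 4, 5} and ℓ ∈ {2, 3, 5, 7}, and let v := ord_ℓ(N_a) be the ℓ-adic valuation of N_a. If p is a prime with p ≡ −1 (mod ℓ^{v+1}), then for every positive integer n not divisible by p, MO(a; pn) ≡ 0 (mod ℓ). -/
open Finset

/-- `MO a n` is MacMahon's coefficient: the sum of the products `s_1 ⋯ s_a` over all
strictly increasing tuples `0 < k_1 < ⋯ < k_a` of positive integers and positive
integers `s_1, …, s_a` with `s_1*k_1 + ⋯ + s_a*k_a = n` (all such data satisfy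
`k_i, s_i ≤ n`, so we may sum over a finite set); in particular `MO a 0 = 0` for `a ≥ 1`. -/
def MO (a n : ℕ) : ℕ :=
  ∑ f ∈ Finset.univ.filter (fun f : Fin a → Fin (n + 1) × Fin (n + 1) =>
      (∀ i, 0 < ((f i).1 : ℕ) ∧ 0 < ((f i).2 : ℕ)) ∧
      (∀ i j : Fin a, i < j → (f i).1 < (f j).1) ∧
      (∑ i, ((f i).2 : ℕ) * ((f i).1 : ℕ)) = n),
    ∏ i, ((f i).2 : ℕ)

/-- The level constants `N_a` of the paper, for `a ∈ {2,3,4,5}`. -/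
def Nlevel : ℕ → ℕ
  | 2 => 2 ^ 3
  | 3 => 2 ^ 7 * 3 * 5
  | 4 => 2 ^ 10 * 3 ^ 3 * 5 * 7
  | 5 => 2 ^ 15 * 3 ^ 3 * 5 ^ 2 * 7
  | _ => 1

section

open PowerSeries

/-- Quadruples `(a, b, x, y)` of positive integers with `a * x + b * y = n`. -/
def quadruples (n : ℕ) : Finset (ℕ × ℕ × ℕ × ℕ) :=
  (range (n + 1) ×ˢ range (n + 1) ×ˢ range (n + 1) ×ˢ range (n + 1)).filter fun q =>
    0 < q.1 ∧ 0 < q.2.1 ∧ 0 < q.2.2.1 ∧ 0 < q.2.2.2 ∧ q.1 * q.2.2.1 + q.2.1 * q.2.2.2 = n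

theorem mem_quadruples {n a b x y : ℕ} : (a, b, x, y) ∈ quadruples n ↔
    0 < a ∧ 0 < b ∧ 0 < x ∧ 0 < y ∧ a * x + b * y = n := by
  simp only [quadruples, mem_filter, mem_product, mem_range, and_iff_right_iff_imp]
  rintro ⟨ha, hb, hx, hy, h⟩
  refine ⟨?_, ?_, ?_, ?_⟩ <;> nlinarith [Nat.mul_pos ha hx, Nat.mul_pos hb hy]

theorem sum_quadruples_snd_lt_fst (n : ℕ) (g : ℕ → ℕ → ℚ) :
    ∑ q ∈ (quadruples n).filter (fun q => q.2.1 < q.1), g q.1 q.2.1 =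
      ∑ q ∈ (quadruples n).filter (fun q => q.1 < q.2.1), g q.2.1 q.1 := by
  refine sum_nbij' (fun q => (q.2.1, q.1, q.2.2.2, q.2.2.1))
    (fun q => (q.2.1, q.1, q.2.2.2, q.2.2.1)) ?_ ?_ ?_ ?_ ?_ <;>
    simp +contextual [mem_quadruples, add_comm]

theorem sum_quadruples_trd_lt_fth (n : ℕ) (g : ℕ → ℕ → ℚ) :
    ∑ q ∈ (quadruples n).filter (fun q => q.2.2.1 < q.2.2.2), g q.1 q.2.1 =
      ∑ q ∈ (quadruples n).filter (fun q => q.2.2.2 < q.2.2.1), g q.2.1 q.1 := by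
  refine sum_nbij' (fun q => (q.2.1, q.1, q.2.2.2, q.2.2.1))
    (fun q => (q.2.1, q.1, q.2.2.2, q.2.2.1)) ?_ ?_ ?_ ?_ ?_ <;>
    simp +contextual [mem_quadruples, add_comm]

/-- The shear `(a, b, x, y) ↦ (a, a + b, x - y, y)`. -/
theorem sum_quadruples_shear (n : ℕ) (g : ℕ → ℕ → ℚ) :
    ∑ q ∈ (quadruples n).filter (fun q => q.1 < q.2.1), g q.1 q.2.1 =
      ∑ q ∈ (quadruples n).filter (fun q => q.2.2.2 < q.2.2.1), g q.1 (q.1 + q.2.1) := by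
  refine sum_nbij' (fun q => (q.1, q.2.1 - q.1, q.2.2.1 + q.2.2.2, q.2.2.2))
    (fun q => (q.1, q.1 + q.2.1, q.2.2.1 - q.2.2.2, q.2.2.2)) ?_ ?_ ?_ ?_ ?_
  · rintro ⟨a, b, x, y⟩ h
    simp only [mem_filter, mem_quadruples] at h ⊢
    obtain ⟨⟨ha, hb, hx, hy, h⟩, hab⟩ := h
    obtain ⟨c, rfl⟩ := Nat.exists_eq_add_of_lt hab
    refine ⟨⟨ha, by omega, by omega, hy, ?_⟩, by omega⟩
    rw [show a + c + 1 - a = c + 1 by omega, ← h]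
    ring
  · rintro ⟨a, b, x, y⟩ h
    simp only [mem_filter, mem_quadruples] at h ⊢
    obtain ⟨⟨ha, hb, hx, hy, h⟩, hxy⟩ := h
    obtain ⟨c, rfl⟩ := Nat.exists_eq_add_of_lt hxy
    refine ⟨⟨ha, by omega, by omega, hy, ?_⟩, by omega⟩
    rw [show y + c + 1 - y = c + 1 by omega, ← h]
    ring
  · rintro ⟨a, b, x, y⟩ h
    simp only [mem_filter, mem_quadruples] at h
    ext <;> dsimp only <;> omega
  · rintro ⟨a, b, x, y⟩ h
    simp only [mem_filter, mem_quadruples] at h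
    ext <;> dsimp only <;> omega
  · rintro ⟨a, b, x, y⟩ h
    simp only [mem_filter, mem_quadruples] at h
    simp only [show a + (b - a) = b by omega]

theorem sum_quadruples_fst_eq_snd (n : ℕ) (g : ℕ → ℕ → ℚ) :
    ∑ q ∈ (quadruples n).filter (fun q => q.1 = q.2.1), g q.1 q.2.1 =
      ∑ d ∈ n.divisors, ((n : ℚ) / d - 1) * g d d := by
  have key : ∀ d ∈ n.divisors,
      ((n : ℚ) / d - 1) * g d d = ∑ _x ∈ Ico 1 (n / d), g d d := by
    intro d hd
    have hd' := Nat.mem_divisors.1 hd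
    have h1 : 1 ≤ n / d := Nat.div_pos (Nat.divisor_le hd) (Nat.pos_of_mem_divisors hd)
    rw [sum_const, Nat.card_Ico, nsmul_eq_mul, Nat.cast_sub h1,
      Nat.cast_div hd'.1 (by exact_mod_cast (Nat.pos_of_mem_divisors hd).ne'), Nat.cast_one]
  rw [sum_congr rfl key, sum_sigma']
  refine sum_nbij' (fun q => ⟨q.1, q.2.2.1⟩)
    (fun p => (p.1, p.1, p.2, n / p.1 - p.2)) ?_ ?_ ?_ ?_ ?_
  · rintro ⟨a, b, x, y⟩ h
    simp only [mem_filter, mem_quadruples] at h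
    obtain ⟨⟨ha, -, hx, hy, h⟩, rfl⟩ := h
    have h' : n = a * (x + y) := by rw [← h]; ring
    have : n / a = x + y := by rw [h', Nat.mul_div_cancel_left _ ha]
    simp only [mem_sigma, Nat.mem_divisors, mem_Ico, this]
    refine ⟨⟨⟨_, h'⟩, ?_⟩, by omega, by omega⟩
    rw [h']; positivity
  · rintro ⟨d, x⟩ h
    simp only [mem_sigma, mem_Ico] at h
    obtain ⟨hd, hx, hx'⟩ := h
    have hd' := Nat.mem_divisors.1 hd
    simp only [mem_filter, mem_quadruples, and_true]
    have := Nat.pos_of_mem_divisors hd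
    refine ⟨this, this, by omega, by omega, ?_⟩
    rw [← mul_add, Nat.add_sub_cancel' hx'.le, Nat.mul_div_cancel' hd'.1]
  · rintro ⟨a, b, x, y⟩ h
    simp only [mem_filter, mem_quadruples] at h
    obtain ⟨⟨ha, -, hx, hy, h⟩, rfl⟩ := h
    have h' : n = a * (x + y) := by rw [← h]; ring
    have : n / a = x + y := by rw [h', Nat.mul_div_cancel_left _ ha]
    simp [this]
  · simp
  · rintro ⟨a, b, x, y⟩ h
    simp only [mem_filter, mem_quadruples] at h
    simp [h.2]

theorem sum_quadruples_trd_eq_fth (n : ℕ) (g : ℕ → ℕ → ℚ) :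
    ∑ q ∈ (quadruples n).filter (fun q => q.2.2.1 = q.2.2.2), g q.1 q.2.1 =
      ∑ d ∈ n.divisors, ∑ c ∈ Ico 1 d, g c (d - c) := by
  rw [sum_sigma']
  refine sum_nbij' (fun q => ⟨q.1 + q.2.1, q.1⟩)
    (fun p => (p.2, p.1 - p.2, n / p.1, n / p.1)) ?_ ?_ ?_ ?_ ?_
  · rintro ⟨a, b, x, y⟩ h
    simp only [mem_filter, mem_quadruples] at h
    obtain ⟨⟨ha, hb, hx, -, h⟩, rfl⟩ := h
    have h' : n = (a + b) * x := by rw [← h]; ring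
    simp only [mem_sigma, Nat.mem_divisors, mem_Ico]
    refine ⟨⟨⟨_, h'⟩, ?_⟩, by omega, by omega⟩
    rw [h']; positivity
  · rintro ⟨d, c⟩ h
    simp only [mem_sigma, mem_Ico] at h
    obtain ⟨hd, hc, hc'⟩ := h
    have hd' := Nat.mem_divisors.1 hd
    simp only [mem_filter, mem_quadruples, and_true]
    have h1 : 0 < n / d := Nat.div_pos (Nat.divisor_le hd) (Nat.pos_of_mem_divisors hd)
    refine ⟨by omega, by omega, h1, h1, ?_⟩
    rw [← add_mul, Nat.add_sub_cancel' hc'.le, Nat.mul_div_cancel' hd'.1]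
  · rintro ⟨a, b, x, y⟩ h
    simp only [mem_filter, mem_quadruples] at h
    obtain ⟨⟨ha, hb, hx, -, h⟩, rfl⟩ := h
    have h' : n = (a + b) * x := by rw [← h]; ring
    have : n / (a + b) = x := by rw [h', Nat.mul_div_cancel_left _ (by omega)]
    simp [this]
  · rintro ⟨d, c⟩ h
    simp only [mem_sigma, mem_Ico] at h
    simp only [Sigma.mk.injEq, heq_eq_eq, and_true]
    omega
  · rintro ⟨a, b, x, y⟩ h
    simp

/-- Sum over all quadruples, split by comparing the entries `u` and `v`. -/
theorem sum_eq_lt_add_gt_add_eq {ι : Type*} (s : Finset ι) (u v : ι → ℕ) (g : ι → ℚ) :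
    ∑ q ∈ s, g q = ∑ q ∈ s.filter (fun q => u q < v q), g q +
      ∑ q ∈ s.filter (fun q => v q < u q), g q + ∑ q ∈ s.filter (fun q => u q = v q), g q := by
  rw [← sum_filter_add_sum_filter_not s (fun q => u q < v q),
    ← sum_filter_add_sum_filter_not (s.filter fun q => ¬ u q < v q) (fun q => v q < u q),
    filter_filter, filter_filter, add_assoc]
  congr 3 <;> ext q <;> simp only [mem_filter, and_congr_right_iff] <;> intro _ <;> omega

/-- If `t` is invariant under the symmetric group acting on triples with sum zero, then the sum
of the odd part of `t` over quadruples reduces to sums over divisors. -/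
theorem sum_quadruples_odd_part (t : ℚ → ℚ → ℚ) (hsymm : ∀ a b, t a b = t b a)
    (heven : ∀ a b, t (-a) (-b) = t a b) (hrot : ∀ a b, t a (-(a + b)) = t a b) (n : ℕ) :
    ∑ q ∈ quadruples n, (t q.1 (-q.2.1) - t q.1 q.2.1) =
      ∑ d ∈ n.divisors, (((n : ℚ) / d - 1) * t d 0 - ∑ c ∈ Ico 1 d, t c (d - c)) := by
  have hneg : ∀ a b, t a (-b) = t b (-a) := by
    intro a b
    rw [← heven, neg_neg, hsymm]
  have hu := sum_eq_lt_add_gt_add_eq (quadruples n) (fun q => q.1) (fun q => q.2.1)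
    (fun q => t q.1 (-q.2.1))
  have ht := sum_eq_lt_add_gt_add_eq (quadruples n) (fun q => q.2.2.1) (fun q => q.2.2.2)
    (fun q => t q.1 q.2.1)
  rw [sum_quadruples_snd_lt_fst n (fun a b => t a (-b)),
    sum_quadruples_fst_eq_snd n (fun a b => t a (-b))] at hu
  rw [sum_quadruples_trd_lt_fth n (fun a b => t a b),
    sum_quadruples_trd_eq_fth n (fun a b => t a b)] at ht
  simp only [hsymm (Prod.fst (Prod.snd _) : ℕ)] at ht
  simp only [hneg (Prod.fst (Prod.snd _) : ℕ)] at hu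
  rw [sum_quadruples_shear n (fun a b => t a (-b))] at hu
  simp only [Nat.cast_add, hrot] at hu
  rw [sum_sub_distrib, hu, ht, sum_sub_distrib]
  have h0 : ∀ d : ℚ, t d (-d) = t d 0 := fun d => by simpa using hrot d 0
  simp only [h0]
  have h1 : ∀ d ∈ n.divisors, ∑ c ∈ Ico 1 d, t c ((d - c : ℕ) : ℚ) = ∑ c ∈ Ico 1 d, t c (d - c) :=
    fun d _ => sum_congr rfl fun c hc => by rw [Nat.cast_sub (mem_Ico.1 hc).2.le]
  rw [sum_congr rfl h1]
  ring

/-- The generating function `∑ σ_k(n) q^n`. -/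
noncomputable def sigmaSeries (k : ℕ) : ℚ⟦X⟧ :=
  PowerSeries.mk fun n => ∑ d ∈ n.divisors, (d : ℚ) ^ k

/-- The derivation `q d/dq`. -/
noncomputable def thetaDeriv : Derivation ℚ ℚ⟦X⟧ ℚ⟦X⟧ := (X : ℚ⟦X⟧) • PowerSeries.derivative ℚ

theorem coeff_thetaDeriv (f : ℚ⟦X⟧) (n : ℕ) : coeff n (thetaDeriv f) = n * coeff n f := by
  rw [thetaDeriv, Derivation.smul_apply, smul_eq_mul]
  cases n with
  | zero => simp
  | succ n => rw [coeff_succ_X_mul, coeff_derivative]; push_cast; ring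

theorem coeff_sigmaSeries (k n : ℕ) :
    coeff n (sigmaSeries k) = ∑ d ∈ n.divisors, (d : ℚ) ^ k := coeff_mk _ _

theorem coeff_sigmaSeries_mul (i j n : ℕ) :
    coeff n (sigmaSeries i * sigmaSeries j) =
      ∑ q ∈ quadruples n, (q.1 : ℚ) ^ i * (q.2.1 : ℚ) ^ j := by
  rw [coeff_mul]
  simp only [coeff_sigmaSeries, sum_mul_sum, ← sum_product']
  rw [sum_sigma']
  refine sum_nbij' (fun p => (p.2.1, p.2.2, p.1.1 / p.2.1, p.1.2 / p.2.2))
    (fun q => ⟨(q.1 * q.2.2.1, q.2.1 * q.2.2.2), (q.1, q.2.1)⟩) ?_ ?_ ?_ ?_ ?_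
  · rintro ⟨⟨m, l⟩, ⟨a, b⟩⟩ h
    simp only [mem_sigma, HasAntidiagonal.mem_antidiagonal, mem_product] at h
    obtain ⟨h, ha, hb⟩ := h
    rw [mem_quadruples]
    refine ⟨Nat.pos_of_mem_divisors ha, Nat.pos_of_mem_divisors hb,
      Nat.div_pos (Nat.divisor_le ha) (Nat.pos_of_mem_divisors ha),
      Nat.div_pos (Nat.divisor_le hb) (Nat.pos_of_mem_divisors hb), ?_⟩
    rw [Nat.mul_div_cancel' (Nat.mem_divisors.1 ha).1,
      Nat.mul_div_cancel' (Nat.mem_divisors.1 hb).1, h]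
  · rintro ⟨a, b, x, y⟩ h
    rw [mem_quadruples] at h
    obtain ⟨ha, hb, hx, hy, h⟩ := h
    simp only [mem_sigma, HasAntidiagonal.mem_antidiagonal, mem_product, Nat.mem_divisors, h,
      dvd_mul_right, true_and]
    exact ⟨(Nat.mul_pos ha hx).ne', (Nat.mul_pos hb hy).ne'⟩
  · rintro ⟨⟨m, l⟩, ⟨a, b⟩⟩ h
    simp only [mem_sigma, HasAntidiagonal.mem_antidiagonal, mem_product] at h
    obtain ⟨h, ha, hb⟩ := h
    simp [Nat.mul_div_cancel' (Nat.mem_divisors.1 ha).1,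
      Nat.mul_div_cancel' (Nat.mem_divisors.1 hb).1]
  · rintro ⟨a, b, x, y⟩ h
    rw [mem_quadruples] at h
    simp [Nat.mul_div_cancel_left _ h.1, Nat.mul_div_cancel_left _ h.2.1]
  · simp

theorem sum_mul_sub (d : ℚ) (m : ℕ) :
    ∑ c ∈ range m, (c : ℚ) * (d - c) =
      d * (m * (m - 1) / 2) - m * (m - 1) * (2 * m - 1) / 6 := by
  induction m with
  | zero => simp
  | succ m ih => rw [sum_range_succ, ih]; push_cast; ring

theorem sum_mul_sub_sq (d : ℚ) (m : ℕ) :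
    ∑ c ∈ range m, ((c : ℚ) * (d - c)) ^ 2 =
      d ^ 2 * (m * (m - 1) * (2 * m - 1) / 6) - 2 * d * (m * (m - 1) / 2) ^ 2 +
        m * (m - 1) * (2 * m - 1) * (3 * m ^ 2 - 3 * m - 1) / 30 := by
  induction m with
  | zero => simp
  | succ m ih => rw [sum_range_succ, ih]; push_cast; ring

theorem sum_mul_sub_cube (d : ℚ) (m : ℕ) :
    ∑ c ∈ range m, ((c : ℚ) * (d - c)) ^ 3 =
      d ^ 3 * (m * (m - 1) / 2) ^ 2 -
        3 * d ^ 2 * (m * (m - 1) * (2 * m - 1) * (3 * m ^ 2 - 3 * m - 1) / 30) +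
        3 * d * (m ^ 2 * (m - 1) ^ 2 * (2 * m ^ 2 - 2 * m - 1) / 12) -
        m * (m - 1) * (2 * m - 1) * (3 * m ^ 4 - 6 * m ^ 3 + 3 * m + 1) / 42 := by
  induction m with
  | zero => simp
  | succ m ih => rw [sum_range_succ, ih]; push_cast; ring

/-- A cubic polynomial in `c * (d - c)` summed over `0 < c < d`. -/
theorem sum_Ico_cubic (α β γ δ : ℚ) {d : ℕ} (hd : 0 < d) :
    ∑ c ∈ Ico 1 d, (α + β * ((c : ℚ) * (d - c)) + γ * ((c : ℚ) * (d - c)) ^ 2 +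
        δ * ((c : ℚ) * (d - c)) ^ 3) =
      α * (d - 1) + β * ((d ^ 3 - d) / 6) + γ * ((d ^ 5 - d) / 30) +
        δ * ((3 * d ^ 7 + 7 * d ^ 3 - 10 * d) / 420) := by
  have h := sum_range_eq_add_Ico (fun c : ℕ => α + β * ((c : ℚ) * (d - c)) +
    γ * ((c : ℚ) * (d - c)) ^ 2 + δ * ((c : ℚ) * (d - c)) ^ 3) hd
  simp only [sum_add_distrib, ← mul_sum, sum_mul_sub, sum_mul_sub_sq, sum_mul_sub_cube,
    sum_const, card_range, nsmul_eq_mul] at h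
  simp only [sum_add_distrib, ← mul_sum, sum_const, nsmul_eq_mul]
  rw [Nat.card_Ico, Nat.cast_sub hd] at h ⊢
  push_cast at h ⊢
  linear_combination -h

theorem sigmaSeries_one_sq :
    (12 : ℚ) • (sigmaSeries 1 * sigmaSeries 1) =
      (5 : ℚ) • sigmaSeries 3 + sigmaSeries 1 - (6 : ℚ) • thetaDeriv (sigmaSeries 1) := by
  ext n
  have h := sum_quadruples_odd_part (fun a b => a ^ 2 + a * b + b ^ 2) (fun a b => by ring)
    (fun a b => by ring) (fun a b => by ring) n
  have hd : ∀ d ∈ n.divisors, ((n : ℚ) / d - 1) * (d ^ 2 + d * 0 + 0 ^ 2) -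
      ∑ c ∈ Ico 1 d, ((c : ℚ) ^ 2 + c * (d - c) + (d - c) ^ 2) =
      n * d ^ 1 - 5 / 6 * d ^ 3 - 1 / 6 * d ^ 1 := by
    intro d hd
    have h1 := Nat.pos_of_mem_divisors hd
    rw [← sum_congr rfl (fun (c : ℕ) _ => show (d : ℚ) ^ 2 + (-1) * ((c : ℚ) * (d - c)) +
      0 * ((c : ℚ) * (d - c)) ^ 2 + 0 * ((c : ℚ) * (d - c)) ^ 3 = _ by ring),
      sum_Ico_cubic _ _ _ _ h1]
    have : (d : ℚ) ≠ 0 := by positivity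
    field_simp
    ring
  rw [sum_congr rfl hd, ← sum_congr rfl (fun q _ => show
      (-2) * ((q.1 : ℚ) ^ 1 * (q.2.1 : ℚ) ^ 1) =
        _ by ring)] at h
  simp only [sum_sub_distrib, ← mul_sum] at h
  simp only [map_add, map_sub, coeff_smul, coeff_thetaDeriv, coeff_sigmaSeries_mul,
    coeff_sigmaSeries, smul_eq_mul]
  linear_combination -6 * h

theorem sum_quadruples_swap (n i j : ℕ) :
    ∑ q ∈ quadruples n, (q.1 : ℚ) ^ i * (q.2.1 : ℚ) ^ j =
      ∑ q ∈ quadruples n, (q.1 : ℚ) ^ j * (q.2.1 : ℚ) ^ i := by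
  rw [← coeff_sigmaSeries_mul, mul_comm, coeff_sigmaSeries_mul]

theorem sigmaSeries_one_mul_three :
    (240 : ℚ) • (sigmaSeries 1 * sigmaSeries 3) =
      (21 : ℚ) • sigmaSeries 5 + (10 : ℚ) • sigmaSeries 3 - sigmaSeries 1 -
        (30 : ℚ) • thetaDeriv (sigmaSeries 3) := by
  ext n
  have h := sum_quadruples_odd_part (fun a b => (a ^ 2 + a * b + b ^ 2) ^ 2) (fun a b => by ring)
    (fun a b => by ring) (fun a b => by ring) n
  have hd : ∀ d ∈ n.divisors, ((n : ℚ) / d - 1) * (((d : ℚ) ^ 2 + (d : ℚ) * 0 + 0 ^ 2) ^ 2) -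
      ∑ c ∈ Ico 1 d, (((c : ℚ) ^ 2 + (c : ℚ) * (d - c) + (d - c) ^ 2) ^ 2) =
      n * d ^ 3 - 7 / 10 * d ^ 5 - 1 / 3 * d ^ 3 + 1 / 30 * d ^ 1 := by
    intro d hd
    have h1 := Nat.pos_of_mem_divisors hd
    rw [← sum_congr rfl (fun (c : ℕ) _ => show (d ^ 4) + (-2 * d ^ 2) * ((c : ℚ) * (d - c)) +
      (1) * ((c : ℚ) * (d - c)) ^ 2 + (0) * ((c : ℚ) * (d - c)) ^ 3 = _ by ring),
      sum_Ico_cubic _ _ _ _ h1]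
    have : (d : ℚ) ≠ 0 := by positivity
    field_simp
    ring
  rw [sum_congr rfl hd, ← sum_congr rfl (fun q _ => show
      (-4) * ((q.1 : ℚ) ^ 1 * (q.2.1 : ℚ) ^ 3) + (-4) * ((q.1 : ℚ) ^ 3 * (q.2.1 : ℚ) ^ 1) =
        _ by ring)] at h
  simp only [sum_add_distrib, sum_sub_distrib, ← mul_sum] at h
  simp only [map_add, map_sub, coeff_smul, coeff_thetaDeriv, coeff_sigmaSeries_mul,
    coeff_sigmaSeries, smul_eq_mul]
  linear_combination -30 * h + 120 * sum_quadruples_swap n 1 3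

theorem sigmaSeries_three_sq :
    (120 : ℚ) • (sigmaSeries 3 * sigmaSeries 3) =
      sigmaSeries 7 - sigmaSeries 3 := by
  ext n
  have h := sum_quadruples_odd_part (fun a b => (a * b * (a + b)) ^ 2) (fun a b => by ring)
    (fun a b => by ring) (fun a b => by ring) n
  have hd : ∀ d ∈ n.divisors, ((n : ℚ) / d - 1) * (((d : ℚ) * 0 * ((d : ℚ) + 0)) ^ 2) -
      ∑ c ∈ Ico 1 d, (((c : ℚ) * (d - c) * ((c : ℚ) + (d - c))) ^ 2) =
      -1 / 30 * d ^ 7 + 1 / 30 * d ^ 3 := by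
    intro d hd
    have h1 := Nat.pos_of_mem_divisors hd
    rw [← sum_congr rfl (fun (c : ℕ) _ => show (0) + (0) * ((c : ℚ) * (d - c)) +
      (d ^ 2) * ((c : ℚ) * (d - c)) ^ 2 + (0) * ((c : ℚ) * (d - c)) ^ 3 = _ by ring),
      sum_Ico_cubic _ _ _ _ h1]
    have : (d : ℚ) ≠ 0 := by positivity
    field_simp
    ring
  rw [sum_congr rfl hd, ← sum_congr rfl (fun q _ => show
      (-4) * ((q.1 : ℚ) ^ 3 * (q.2.1 : ℚ) ^ 3) =
        _ by ring)] at h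
  simp only [sum_add_distrib, ← mul_sum] at h
  simp only [map_sub, coeff_smul, coeff_sigmaSeries_mul,
    coeff_sigmaSeries, smul_eq_mul]
  linear_combination -30 * h

theorem sigmaSeries_one_mul_five :
    (504 : ℚ) • (sigmaSeries 1 * sigmaSeries 5) =
      (20 : ℚ) • sigmaSeries 7 + (21 : ℚ) • sigmaSeries 5 + sigmaSeries 1 -
        (42 : ℚ) • thetaDeriv (sigmaSeries 5) := by
  ext n
  have h := sum_quadruples_odd_part (fun a b => (a ^ 2 + a * b + b ^ 2) ^ 3) (fun a b => by ring)
    (fun a b => by ring) (fun a b => by ring) n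
  have hd : ∀ d ∈ n.divisors, ((n : ℚ) / d - 1) * (((d : ℚ) ^ 2 + (d : ℚ) * 0 + 0 ^ 2) ^ 3) -
      ∑ c ∈ Ico 1 d, (((c : ℚ) ^ 2 + (c : ℚ) * (d - c) + (d - c) ^ 2) ^ 3) =
      n * d ^ 5 - (1 - 1 / 2 + 1 / 10 - 1 / 140) * d ^ 7 - 1 / 2 * d ^ 5 +
        (1 / 10 + 1 / 60) * d ^ 3 - 1 / 42 * d ^ 1 := by
    intro d hd
    have h1 := Nat.pos_of_mem_divisors hd
    rw [← sum_congr rfl (fun (c : ℕ) _ => show (d ^ 6) + (-3 * d ^ 4) * ((c : ℚ) * (d - c)) +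
      (3 * d ^ 2) * ((c : ℚ) * (d - c)) ^ 2 + (-1) * ((c : ℚ) * (d - c)) ^ 3 = _ by ring),
      sum_Ico_cubic _ _ _ _ h1]
    have : (d : ℚ) ≠ 0 := by positivity
    field_simp
    ring
  rw [sum_congr rfl hd, ← sum_congr rfl (fun q _ => show
      (-6) * ((q.1 : ℚ) ^ 1 * (q.2.1 : ℚ) ^ 5) + (-6) * ((q.1 : ℚ) ^ 5 * (q.2.1 : ℚ) ^ 1) +
        (-14) * ((q.1 : ℚ) ^ 3 * (q.2.1 : ℚ) ^ 3) =
        _ by ring)] at h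
  simp only [sum_add_distrib, sum_sub_distrib, ← mul_sum] at h
  simp only [map_add, map_sub, coeff_smul, coeff_thetaDeriv, coeff_sigmaSeries_mul,
    coeff_sigmaSeries, smul_eq_mul]
  have h' := congrArg (coeff n) sigmaSeries_three_sq
  simp only [map_sub, coeff_smul, coeff_sigmaSeries_mul, coeff_sigmaSeries, smul_eq_mul] at h'
  linear_combination -42 * h + 252 * sum_quadruples_swap n 1 5 - 49 / 10 * h'

theorem sigmaSeries_three_mul_five :
    (5040 : ℚ) • (sigmaSeries 3 * sigmaSeries 5) =
      (11 : ℚ) • sigmaSeries 9 - (21 : ℚ) • sigmaSeries 5 + (10 : ℚ) • sigmaSeries 3 := by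
  ext n
  have h := sum_quadruples_odd_part (fun a b => (a ^ 2 + a * b + b ^ 2) * (a * b * (a + b)) ^ 2)
    (fun a b => by ring) (fun a b => by ring) (fun a b => by ring) n
  have hd : ∀ d ∈ n.divisors, ((n : ℚ) / d - 1) *
      (((d : ℚ) ^ 2 + (d : ℚ) * 0 + 0 ^ 2) * ((d : ℚ) * 0 * ((d : ℚ) + 0)) ^ 2) -
      ∑ c ∈ Ico 1 d, (((c : ℚ) ^ 2 + (c : ℚ) * (d - c) + (d - c) ^ 2) *
        ((c : ℚ) * (d - c) * ((c : ℚ) + (d - c))) ^ 2) =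
      -(1 / 30 - 1 / 140) * d ^ 9 + (1 / 30 + 1 / 60) * d ^ 5 - 1 / 42 * d ^ 3 := by
    intro d hd
    have h1 := Nat.pos_of_mem_divisors hd
    rw [← sum_congr rfl (fun (c : ℕ) _ => show (0) + (0) * ((c : ℚ) * (d - c)) +
      (d ^ 4) * ((c : ℚ) * (d - c)) ^ 2 + (-d ^ 2) * ((c : ℚ) * (d - c)) ^ 3 = _ by ring),
      sum_Ico_cubic _ _ _ _ h1]
    have : (d : ℚ) ≠ 0 := by positivity
    field_simp
    ring
  rw [sum_congr rfl hd, ← sum_congr rfl (fun q _ => show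
      (-6) * ((q.1 : ℚ) ^ 3 * (q.2.1 : ℚ) ^ 5) + (-6) * ((q.1 : ℚ) ^ 5 * (q.2.1 : ℚ) ^ 3) =
        _ by ring)] at h
  simp only [sum_add_distrib, sum_sub_distrib, ← mul_sum] at h
  simp only [map_add, map_sub, coeff_smul, coeff_sigmaSeries_mul,
    coeff_sigmaSeries, smul_eq_mul]
  linear_combination -420 * h + 2520 * sum_quadruples_swap n 3 5

theorem mk_eq_mk_cast_mul (f g : ℕ → ℚ) (hf0 : f 0 = 0) (hf1 : f 1 = 0) (hg0 : g 0 = 0)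
    (h : ∀ n, f (n + 2) - 2 * f (n + 1) + f n = g (n + 1)) :
    PowerSeries.mk f = PowerSeries.mk (fun s => (s : ℚ)) * PowerSeries.mk g := by
  have expand_sq : ∀ F : ℚ⟦X⟧, (1 - X) ^ 2 * F = F - (2 : ℚ) • (X * F) + X * (X * F) := by
    intro F
    algebra
  have hF : (1 - X : ℚ⟦X⟧) ^ 2 * PowerSeries.mk f = X * PowerSeries.mk g := by
    rw [expand_sq]
    ext n
    rcases n with _ | _ | n
    · simp [hf0]
    · simp [hf0, hf1, hg0, coeff_succ_X_mul]
    · simp only [map_add, map_sub, coeff_smul, coeff_succ_X_mul, coeff_mk, smul_eq_mul]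
      exact h n
  have hI : (1 - X : ℚ⟦X⟧) ^ 2 * PowerSeries.mk (fun s => (s : ℚ)) = X := by
    rw [expand_sq]
    ext n
    rcases n with _ | _ | n
    · simp
    · simp [coeff_succ_X_mul]
    · simp only [map_add, map_sub, coeff_smul, coeff_succ_X_mul, coeff_mk, smul_eq_mul, coeff_X]
      push_cast
      ring
  have h0 : (1 - X : ℚ⟦X⟧) ^ 2 ≠ 0 := pow_ne_zero _ fun h => by
    simpa using congrArg constantCoeff h
  refine mul_left_cancel₀ h0 ?_
  rw [hF, ← mul_assoc, hI]

theorem mk_cast_sq : (PowerSeries.mk fun s => (s : ℚ)) ^ 2 =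
    PowerSeries.mk fun s => ((s : ℚ) ^ 3 - s) / 6 := by
  rw [pow_succ', pow_one, ← mk_eq_mk_cast_mul] <;> intros <;> push_cast <;> ring

theorem mk_cast_pow_three : (PowerSeries.mk fun s => (s : ℚ)) ^ 3 =
    PowerSeries.mk fun s => ((s : ℚ) ^ 5 - 5 * s ^ 3 + 4 * s) / 120 := by
  rw [pow_succ', mk_cast_sq, ← mk_eq_mk_cast_mul] <;> intros <;> push_cast <;> ring

theorem mk_cast_pow_four : (PowerSeries.mk fun s => (s : ℚ)) ^ 4 =
    PowerSeries.mk fun s => ((s : ℚ) ^ 7 - 14 * s ^ 5 + 49 * s ^ 3 - 36 * s) / 5040 := by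
  rw [pow_succ', mk_cast_pow_three, ← mk_eq_mk_cast_mul] <;> intros <;> push_cast <;> ring

theorem mk_cast_pow_five : (PowerSeries.mk fun s => (s : ℚ)) ^ 5 =
    PowerSeries.mk fun s =>
      ((s : ℚ) ^ 9 - 30 * s ^ 7 + 273 * s ^ 5 - 820 * s ^ 3 + 576 * s) / 362880 := by
  rw [pow_succ', mk_cast_pow_four, ← mk_eq_mk_cast_mul] <;> intros <;> push_cast <;> ring

/-- Newton's identities solved for the elementary symmetric polynomials of degree at most `5`. -/
theorem esymm_eq_psum {σ A : Type*} [Fintype σ] [CommRing A] (x : σ → A) :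
    let e := fun a => ∑ t ∈ powersetCard a (univ : Finset σ), ∏ k ∈ t, x k
    let p := fun r => ∑ k, x k ^ r
    2 * e 2 = p 1 ^ 2 - p 2 ∧
    6 * e 3 = p 1 ^ 3 - 3 * p 1 * p 2 + 2 * p 3 ∧
    24 * e 4 = p 1 ^ 4 - 6 * p 1 ^ 2 * p 2 + 3 * p 2 ^ 2 + 8 * p 1 * p 3 - 6 * p 4 ∧
    120 * e 5 = p 1 ^ 5 - 10 * p 1 ^ 3 * p 2 + 20 * p 1 ^ 2 * p 3 + 15 * p 1 * p 2 ^ 2 -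
      30 * p 1 * p 4 - 20 * p 2 * p 3 + 24 * p 5 := by
  intro e p
  have newton : ∀ k : ℕ, (k : A) * e k = (-1) ^ (k + 1) *
      ∑ a ∈ antidiagonal k with a.1 < k, (-1) ^ a.1 * e a.1 * p a.2 := by
    intro k
    have h := congrArg (MvPolynomial.aeval x) (MvPolynomial.mul_esymm_eq_sum σ ℤ k)
    simpa [MvPolynomial.esymm, MvPolynomial.psum, e, p] using h
  have e0 : e 0 = 1 := by simp [e]
  have e1 := newton 1
  have e2 := newton 2
  have e3 := newton 3
  have e4 := newton 4
  have e5 := newton 5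
  simp only [sum_filter, Nat.antidiagonal_succ, Nat.antidiagonal_zero, sum_cons, sum_map]
    at e1 e2 e3 e4 e5
  simp [e0] at e1 e2 e3 e4 e5
  rw [e1] at e2 e3 e4 e5
  have h2 : 2 * e 2 = p 1 ^ 2 - p 2 := by linear_combination e2
  have h3 : 6 * e 3 = p 1 ^ 3 - 3 * p 1 * p 2 + 2 * p 3 := by
    linear_combination 2 * e3 + p 1 * h2
  have h4 : 24 * e 4 = p 1 ^ 4 - 6 * p 1 ^ 2 * p 2 + 3 * p 2 ^ 2 + 8 * p 1 * p 3 - 6 * p 4 := by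
    linear_combination 6 * e4 - 3 * p 2 * h2 + p 1 * h3
  exact ⟨h2, h3, h4, by linear_combination 24 * e5 + 12 * p 3 * h2 - 4 * p 2 * h3 + p 1 * h4⟩

theorem sum_powersetCard_eq_sum_strictMono {A : Type*} [CommRing A] (a N : ℕ) (y : Fin N → A) :
    ∑ t ∈ powersetCard a (univ : Finset (Fin N)), ∏ k ∈ t, y k =
      ∑ f ∈ univ.filter (fun f : Fin a → Fin N => StrictMono f), ∏ i, y (f i) := by
  symm
  refine sum_nbij (fun f => univ.image f) ?_ ?_ ?_ ?_
  · intro f hf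
    have hf := (mem_filter.1 hf).2
    simp [mem_powersetCard, card_image_of_injective _ hf.injective]
  · intro f hf g hg h
    simp only [coe_filter, mem_univ, true_and, Set.mem_ofPred_eq] at hf hg
    refine (StrictMono.range_inj hf hg).1 ?_
    simpa [Set.image_univ] using congrArg (fun s : Finset (Fin N) => (s : Set (Fin N))) h
  · intro t ht
    have ht := (mem_powersetCard.1 ht).2
    refine ⟨t.orderEmbOfFin ht, ?_, ?_⟩
    · simpa using (t.orderEmbOfFin ht).strictMono
    · simp
  · intro f hf
    have hf := (mem_filter.1 hf).2
    rw [prod_image hf.injective.injOn]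

/-- The truncation of `q^k / (1 - q^k)^2` to the terms `s * q^(s * k)` with `s ≤ n`. -/
noncomputable def truncatedFactor (n k : ℕ) : ℚ⟦X⟧ :=
  if k = 0 then 0 else ∑ s : Fin (n + 1), C ((s : ℕ) : ℚ) * X ^ ((s : ℕ) * k)

theorem cast_MO (a n : ℕ) :
    (MO a n : ℚ) = coeff n (∑ t ∈ powersetCard a (univ : Finset (Fin (n + 1))),
      ∏ k ∈ t, truncatedFactor n k) := by
  have hprod : ∀ f : Fin a → Fin (n + 1), coeff n (∏ i, truncatedFactor n (f i)) =
      ∑ s : Fin a → Fin (n + 1), if (∀ i, 0 < (f i : ℕ)) ∧ ∑ i, (s i : ℕ) * (f i : ℕ) = n then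
        ∏ i, ((s i : ℕ) : ℚ) else 0 := by
    intro f
    by_cases hf : ∀ i, 0 < (f i : ℕ)
    · rw [prod_congr rfl fun i _ => show truncatedFactor n (f i) = _ from if_neg (hf i).ne',
        prod_univ_sum, Fintype.piFinset_univ, map_sum]
      refine sum_congr rfl fun s _ => ?_
      rw [prod_mul_distrib, ← map_prod, prod_pow_eq_pow_sum, coeff_C_mul, coeff_X_pow]
      simp [hf, eq_comm]
    · have hf' := hf
      push Not at hf'
      obtain ⟨i, hi⟩ := hf'
      rw [prod_eq_zero (mem_univ i)
        (show truncatedFactor n (f i) = 0 from if_pos (Nat.le_zero.1 hi))]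
      simp only [hf, false_and, if_false, sum_const_zero, map_zero]
  rw [sum_powersetCard_eq_sum_strictMono, map_sum, sum_congr rfl fun f _ => hprod f, MO,
    sum_filter, sum_filter, Nat.cast_sum, ← (Equiv.arrowProdEquivProdArrow _ _ _).symm.sum_comp,
    Fintype.sum_prod_type]
  refine sum_congr rfl fun f _ => ?_
  by_cases hm : StrictMono f
  · rw [if_pos hm]
    refine sum_congr rfl fun s _ => ?_
    have hm' : ∀ i j : Fin a, i < j → f i < f j := fun i j h => hm h
    simp only [Equiv.arrowProdEquivProdArrow, Equiv.coe_fn_symm_mk]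
    by_cases hs : ∀ i, 0 < (s i : ℕ)
    · simp only [hs, and_true, eq_true hm', true_and]
      push_cast
      rfl
    · push Not at hs
      obtain ⟨i, hi⟩ := hs
      have h0 : ∏ i, (s i : ℕ) = 0 := prod_eq_zero (mem_univ i) (Nat.le_zero.1 hi)
      rw [← Nat.cast_prod, h0]
      simp
  · rw [if_neg hm]
    refine sum_eq_zero fun s _ => ?_
    rw [if_neg, Nat.cast_zero]
    exact fun h => hm fun i j hij => h.2.1 i j hij

theorem coeff_truncatedFactor {n k m : ℕ} (hk : k ≠ 0) (hm : m ≤ n) :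
    coeff m (truncatedFactor n k) =
      coeff m (expand k hk (PowerSeries.mk fun s => (s : ℚ))) := by
  rw [truncatedFactor, if_neg hk, map_sum, coeff_expand]
  simp only [coeff_C_mul, coeff_X_pow]
  split_ifs with h
  · obtain ⟨s, rfl⟩ := h
    have hs : s < n + 1 := by nlinarith [Nat.pos_of_ne_zero hk]
    rw [sum_eq_single ⟨s, hs⟩]
    · simp [Nat.mul_div_cancel_left _ (Nat.pos_of_ne_zero hk), mul_comm]
    · intro b _ hb
      have : k * s ≠ b * k := fun h => hb (Fin.ext (by
        rw [mul_comm] at h; exact (Nat.eq_of_mul_eq_mul_right (Nat.pos_of_ne_zero hk) h).symm))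
      simp [this]
    · simp
  · refine sum_eq_zero fun s _ => ?_
    have : m ≠ s * k := fun h' => h ⟨s, by rw [h', mul_comm]⟩
    simp [this]

/-- `f ≡ g` modulo `q^(n+1)` as an equality in the quotient ring. -/
theorem quotient_mk_eq_iff {n : ℕ} {f g : ℚ⟦X⟧} :
    Ideal.Quotient.mk (Ideal.span {(X : ℚ⟦X⟧) ^ (n + 1)}) f = Ideal.Quotient.mk _ g ↔
      ∀ m ≤ n, coeff m f = coeff m g := by
  rw [Ideal.Quotient.mk_eq_mk_iff_sub_mem, Ideal.mem_span_singleton, X_pow_dvd_iff]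
  simp only [Nat.lt_succ_iff, map_sub, sub_eq_zero]

theorem sum_truncatedFactor_pow {n r : ℕ} (hr : r ≠ 0) {f : ℕ → ℚ} (hf0 : f 0 = 0)
    (hf : (PowerSeries.mk fun s => (s : ℚ)) ^ r = PowerSeries.mk f) :
    Ideal.Quotient.mk (Ideal.span {(X : ℚ⟦X⟧) ^ (n + 1)})
        (∑ k : Fin (n + 1), truncatedFactor n k ^ r) =
      Ideal.Quotient.mk _ (PowerSeries.mk fun m => ∑ d ∈ m.divisors, f d) := by
  have h1 : ∀ k : Fin (n + 1),
      Ideal.Quotient.mk (Ideal.span {(X : ℚ⟦X⟧) ^ (n + 1)}) (truncatedFactor n k ^ r) =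
      Ideal.Quotient.mk _ (if hk : (k : ℕ) = 0 then 0 else expand k hk (PowerSeries.mk f)) := by
    intro k
    by_cases hk : (k : ℕ) = 0
    · simp [truncatedFactor, hk, hr]
    · rw [dif_neg hk, ← hf, map_pow, map_pow, map_pow]
      congr 1
      exact quotient_mk_eq_iff.2 fun m hm => coeff_truncatedFactor hk hm
  rw [map_sum, sum_congr rfl fun k _ => h1 k, ← map_sum, quotient_mk_eq_iff]
  intro m hm
  rw [map_sum, Fin.sum_univ_eq_sum_range (fun k => coeff m
    (if hk : k = 0 then 0 else expand k hk (PowerSeries.mk f))), coeff_mk,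
    ← Nat.sum_div_divisors m f]
  rcases Nat.eq_zero_or_pos m with rfl | hmpos
  · rw [Nat.divisors_zero, sum_empty]
    refine sum_eq_zero fun k _ => ?_
    split_ifs with hk
    · simp
    · simp [coeff_expand, hf0]
  · symm
    refine sum_subset_zero_on_sdiff ?_ ?_ ?_
    · intro d hd
      have := Nat.divisor_le hd
      simp only [mem_range]
      omega
    · intro k hk
      simp only [mem_sdiff, Nat.mem_divisors, not_and, not_not] at hk
      split_ifs with h
      · simp
      · rw [coeff_expand, if_neg fun h' => hmpos.ne' (hk.2 h')]
    · intro d hd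
      rw [dif_neg (Nat.pos_of_mem_divisors hd).ne', coeff_expand,
        if_pos (Nat.mem_divisors.1 hd).1, coeff_mk]

theorem thetaDeriv_sigmaSeries_one : thetaDeriv (sigmaSeries 1) =
    (5 / 6 : ℚ) • sigmaSeries 3 + (1 / 6 : ℚ) • sigmaSeries 1 - (2 : ℚ) • sigmaSeries 1 ^ 2 := by
  linear_combination (norm := algebra) (1 / 6 : ℚ) • sigmaSeries_one_sq

theorem thetaDeriv_sigmaSeries_three : thetaDeriv (sigmaSeries 3) =
    (7 / 10 : ℚ) • sigmaSeries 5 + (1 / 3 : ℚ) • sigmaSeries 3 - (1 / 30 : ℚ) • sigmaSeries 1 -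
      (8 : ℚ) • (sigmaSeries 1 * sigmaSeries 3) := by
  linear_combination (norm := algebra) (1 / 30 : ℚ) • sigmaSeries_one_mul_three

theorem sigmaSeries_seven : sigmaSeries 7 =
    (120 : ℚ) • sigmaSeries 3 ^ 2 + sigmaSeries 3 := by
  linear_combination (norm := algebra) (-1 : ℚ) • sigmaSeries_three_sq

theorem thetaDeriv_sigmaSeries_five : thetaDeriv (sigmaSeries 5) =
    (10 / 21 : ℚ) • ((120 : ℚ) • sigmaSeries 3 ^ 2 + sigmaSeries 3) +
      (1 / 2 : ℚ) • sigmaSeries 5 + (1 / 42 : ℚ) • sigmaSeries 1 -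
      (12 : ℚ) • (sigmaSeries 1 * sigmaSeries 5) := by
  rw [← sigmaSeries_seven]
  linear_combination (norm := algebra) (1 / 42 : ℚ) • sigmaSeries_one_mul_five

theorem sigmaSeries_nine : sigmaSeries 9 =
    (5040 / 11 : ℚ) • (sigmaSeries 3 * sigmaSeries 5) + (21 / 11 : ℚ) • sigmaSeries 5 -
      (10 / 11 : ℚ) • sigmaSeries 3 := by
  linear_combination (norm := algebra) (-1 / 11 : ℚ) • sigmaSeries_three_mul_five

theorem factorial_mul_MO (n : ℕ) :
    let q₁ := sigmaSeries 1
    let q₂ := (1 / 6 : ℚ) • (sigmaSeries 3 - sigmaSeries 1)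
    let q₃ := (1 / 120 : ℚ) • (sigmaSeries 5 - (5 : ℚ) • sigmaSeries 3 + (4 : ℚ) • sigmaSeries 1)
    let q₄ := (1 / 5040 : ℚ) • (sigmaSeries 7 - (14 : ℚ) • sigmaSeries 5 +
      (49 : ℚ) • sigmaSeries 3 - (36 : ℚ) • sigmaSeries 1)
    let q₅ := (1 / 362880 : ℚ) • (sigmaSeries 9 - (30 : ℚ) • sigmaSeries 7 +
      (273 : ℚ) • sigmaSeries 5 - (820 : ℚ) • sigmaSeries 3 + (576 : ℚ) • sigmaSeries 1)
    2 * (MO 2 n : ℚ) = coeff n (q₁ ^ 2 - q₂) ∧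
    6 * (MO 3 n : ℚ) = coeff n (q₁ ^ 3 - 3 * q₁ * q₂ + 2 * q₃) ∧
    24 * (MO 4 n : ℚ) =
      coeff n (q₁ ^ 4 - 6 * q₁ ^ 2 * q₂ + 3 * q₂ ^ 2 + 8 * q₁ * q₃ - 6 * q₄) ∧
    120 * (MO 5 n : ℚ) =
      coeff n (q₁ ^ 5 - 10 * q₁ ^ 3 * q₂ + 20 * q₁ ^ 2 * q₃ + 15 * q₁ * q₂ ^ 2 -
        30 * q₁ * q₄ - 20 * q₂ * q₃ + 24 * q₅) := by
  intro q₁ q₂ q₃ q₄ q₅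
  let π := Ideal.Quotient.mk (Ideal.span {(X : ℚ⟦X⟧) ^ (n + 1)})
  have hq : ∀ m : ℕ, ∀ f g : ℕ → ℚ, (∀ d, f d = g d) →
      ∑ d ∈ m.divisors, f d = ∑ d ∈ m.divisors, g d := fun m f g h => sum_congr rfl fun d _ => h d
  have h1 : π (∑ k : Fin (n + 1), truncatedFactor n k ^ 1) = π q₁ := by
    rw [sum_truncatedFactor_pow one_ne_zero Nat.cast_zero (pow_one _)]
    simp only [q₁, sigmaSeries, pow_one, π]
  have h2 : π (∑ k : Fin (n + 1), truncatedFactor n k ^ 2) = π q₂ := by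
    rw [sum_truncatedFactor_pow two_ne_zero (by simp) mk_cast_sq]
    congr 1
    ext m
    simp only [q₂, map_sub, coeff_smul, coeff_sigmaSeries, coeff_mk, smul_eq_mul,
      ← sum_sub_distrib, mul_sum]
    exact hq _ _ _ fun d => by ring
  have h3 : π (∑ k : Fin (n + 1), truncatedFactor n k ^ 3) = π q₃ := by
    rw [sum_truncatedFactor_pow three_ne_zero (by simp) mk_cast_pow_three]
    congr 1
    ext m
    simp only [q₃, map_add, map_sub, coeff_smul, coeff_sigmaSeries, coeff_mk, smul_eq_mul,
      ← sum_add_distrib, ← sum_sub_distrib, mul_sum]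
    exact hq _ _ _ fun d => by ring
  have h4 : π (∑ k : Fin (n + 1), truncatedFactor n k ^ 4) = π q₄ := by
    rw [sum_truncatedFactor_pow four_ne_zero (by simp) mk_cast_pow_four]
    congr 1
    ext m
    simp only [q₄, map_add, map_sub, coeff_smul, coeff_sigmaSeries, coeff_mk, smul_eq_mul,
      ← sum_add_distrib, ← sum_sub_distrib, mul_sum]
    exact hq _ _ _ fun d => by ring
  have h5 : π (∑ k : Fin (n + 1), truncatedFactor n k ^ 5) = π q₅ := by
    rw [sum_truncatedFactor_pow (by norm_num) (by simp) mk_cast_pow_five]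
    congr 1
    ext m
    simp only [q₅, map_add, map_sub, coeff_smul, coeff_sigmaSeries, coeff_mk, smul_eq_mul,
      ← sum_add_distrib, ← sum_sub_distrib, mul_sum]
    exact hq _ _ _ fun d => by ring
  have hMO : ∀ (a c : ℕ) (g : ℚ⟦X⟧), π (c * ∑ t ∈ powersetCard a (univ : Finset (Fin (n + 1))),
      ∏ k ∈ t, truncatedFactor n k) = π g → c * (MO a n : ℚ) = coeff n g := by
    intro a c g h
    rw [← quotient_mk_eq_iff.1 h n le_rfl, cast_MO, ← nsmul_eq_mul, ← nsmul_eq_mul, map_nsmul]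
  obtain ⟨e2, e3, e4, e5⟩ := esymm_eq_psum (fun k : Fin (n + 1) => truncatedFactor n k)
  refine ⟨hMO 2 2 _ ?_, hMO 3 6 _ ?_, hMO 4 24 _ ?_, hMO 5 120 _ ?_⟩ <;>
  simp only [Nat.cast_ofNat, e2, e3, e4, e5, map_add, map_sub, map_mul, map_ofNat, map_pow π q₁,
    map_pow π q₂, map_pow π (∑ k : Fin (n + 1), truncatedFactor n k ^ 1),
    map_pow π (∑ k : Fin (n + 1), truncatedFactor n k ^ 2), h1, h2, h3, h4, h5]

theorem mul_MO_two (n : ℕ) : 8 * (MO 2 n : ℚ) = coeff n (sigmaSeries 1 -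
    (2 : ℚ) • thetaDeriv (sigmaSeries 1) + sigmaSeries 3) := by
  trans (4 : ℚ) * (2 * MO 2 n)
  · ring
  rw [(factorial_mul_MO n).1, ← smul_eq_mul, ← coeff_smul]
  congr 1
  simp only [thetaDeriv_sigmaSeries_one]
  algebra

theorem mul_MO_three (n : ℕ) : 1920 * (MO 3 n : ℚ) = coeff n (
    (37 : ℚ) • sigmaSeries 1 - (100 : ℚ) • thetaDeriv (sigmaSeries 1) +
      (40 : ℚ) • thetaDeriv (thetaDeriv (sigmaSeries 1)) +
    (50 : ℚ) • sigmaSeries 3 - (30 : ℚ) • thetaDeriv (sigmaSeries 3) +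
    (3 : ℚ) • sigmaSeries 5) := by
  trans (320 : ℚ) * (6 * MO 3 n)
  · ring
  rw [(factorial_mul_MO n).2.1, ← smul_eq_mul, ← coeff_smul]
  congr 1
  simp only [thetaDeriv_sigmaSeries_one, thetaDeriv_sigmaSeries_three, map_add, map_sub,
    Derivation.map_smul, Derivation.leibniz, pow_two, smul_eq_mul]
  algebra

theorem mul_MO_four (n : ℕ) : (2 ^ 10 * 3 ^ 3 * 5 * 7) * (MO 4 n : ℚ) = coeff n (
    (3229 : ℚ) • sigmaSeries 1 - (9870 : ℚ) • thetaDeriv (sigmaSeries 1) +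
      (5880 : ℚ) • thetaDeriv (thetaDeriv (sigmaSeries 1)) -
      (840 : ℚ) • thetaDeriv (thetaDeriv (thetaDeriv (sigmaSeries 1))) +
    (4935 : ℚ) • sigmaSeries 3 - (4410 : ℚ) • thetaDeriv (sigmaSeries 3) +
      (756 : ℚ) • thetaDeriv (thetaDeriv (sigmaSeries 3)) +
    (441 : ℚ) • sigmaSeries 5 - (126 : ℚ) • thetaDeriv (sigmaSeries 5) +
    (5 : ℚ) • sigmaSeries 7) := by
  trans (40320 : ℚ) * (24 * MO 4 n)
  · ring
  rw [(factorial_mul_MO n).2.2.1, ← smul_eq_mul, ← coeff_smul]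
  congr 1
  simp only [thetaDeriv_sigmaSeries_one, thetaDeriv_sigmaSeries_three,
    thetaDeriv_sigmaSeries_five, sigmaSeries_seven, map_add, map_sub,
    Derivation.map_smul, Derivation.leibniz, pow_two, smul_eq_mul]
  algebra

theorem mul_MO_five (n : ℕ) : (2 ^ 15 * 3 ^ 3 * 5 ^ 2 * 7) * (MO 5 n : ℚ) = coeff n (
    (96111 : ℚ) • sigmaSeries 1 - (314200 : ℚ) • thetaDeriv (sigmaSeries 1) +
      (223440 : ℚ) • thetaDeriv (thetaDeriv (sigmaSeries 1)) -
      (50400 : ℚ) • thetaDeriv (thetaDeriv (thetaDeriv (sigmaSeries 1))) +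
      (3360 : ℚ) • thetaDeriv (thetaDeriv (thetaDeriv (thetaDeriv (sigmaSeries 1)))) +
    (157100 : ℚ) • sigmaSeries 3 - (167580 : ℚ) • thetaDeriv (sigmaSeries 3) +
      (45360 : ℚ) • thetaDeriv (thetaDeriv (sigmaSeries 3)) -
      (3360 : ℚ) • thetaDeriv (thetaDeriv (thetaDeriv (sigmaSeries 3))) +
    (16758 : ℚ) • sigmaSeries 5 - (7560 : ℚ) • thetaDeriv (sigmaSeries 5) +
      (720 : ℚ) • thetaDeriv (thetaDeriv (sigmaSeries 5)) +
    (300 : ℚ) • sigmaSeries 7 - (50 : ℚ) • thetaDeriv (sigmaSeries 7) +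
    sigmaSeries 9) := by
  trans (1290240 : ℚ) * (120 * MO 5 n)
  · ring
  rw [(factorial_mul_MO n).2.2.2, ← smul_eq_mul, ← coeff_smul]
  congr 1
  simp only [thetaDeriv_sigmaSeries_one, thetaDeriv_sigmaSeries_three,
    thetaDeriv_sigmaSeries_five, sigmaSeries_seven, sigmaSeries_nine, map_add, map_sub,
    Derivation.map_smul, Derivation.leibniz, pow_two, smul_eq_mul]
  algebra

theorem exists_Nlevel_mul_MO {a : ℕ} (ha : a ∈ ({2, 3, 4, 5} : Finset ℕ)) :
    ∃ P : ℕ → Fin 5 → ℤ, ∀ n : ℕ, (Nlevel a : ℤ) * MO a n =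
      ∑ j : Fin 5, P n j * ∑ d ∈ n.divisors, (d : ℤ) ^ (2 * (j : ℕ) + 1) := by
  simp only [mem_insert, mem_singleton] at ha
  rcases ha with rfl | rfl | rfl | rfl
  on_goal 1 => refine ⟨fun n => ![1 - 2 * n, 1, 0, 0, 0], fun n => ?_⟩; have h := mul_MO_two n
  on_goal 2 =>
    refine ⟨fun n => ![37 - 100 * n + 40 * n ^ 2, 50 - 30 * n, 3, 0, 0], fun n => ?_⟩
    have h := mul_MO_three n
  on_goal 3 =>
    refine ⟨fun n => ![3229 - 9870 * n + 5880 * n ^ 2 - 840 * n ^ 3,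
      4935 - 4410 * n + 756 * n ^ 2, 441 - 126 * n, 5, 0], fun n => ?_⟩
    have h := mul_MO_four n
  on_goal 4 =>
    refine ⟨fun n => ![96111 - 314200 * n + 223440 * n ^ 2 - 50400 * n ^ 3 + 3360 * n ^ 4,
      157100 - 167580 * n + 45360 * n ^ 2 - 3360 * n ^ 3, 16758 - 7560 * n + 720 * n ^ 2,
      300 - 50 * n, 1], fun n => ?_⟩
    have h := mul_MO_five n
  all_goals
    simp only [map_add, map_sub, coeff_smul, coeff_thetaDeriv, coeff_sigmaSeries, smul_eq_mul] at h
    qify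
    simp [Fin.sum_univ_five, Nlevel] at h ⊢
    linear_combination h

theorem sum_divisors_prime_mul_pow {p n : ℕ} (hp : p.Prime) (hpn : ¬ p ∣ n) (k : ℕ) :
    ∑ d ∈ (p * n).divisors, (d : ℤ) ^ k = (1 + (p : ℤ) ^ k) * ∑ d ∈ n.divisors, (d : ℤ) ^ k := by
  have hc : p.Coprime n := (Nat.Prime.coprime_iff_not_dvd hp).2 hpn
  have h := ArithmeticFunction.isMultiplicative_sigma (k := k).map_mul_of_coprime hc
  simp only [ArithmeticFunction.sigma_apply, hp.sum_divisors, one_pow] at h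
  rw [add_comm (1 : ℤ)]
  exact_mod_cast h

theorem dvd_one_add_pow_odd {m p : ℤ} (h : p ≡ -1 [ZMOD m]) (j : ℕ) :
    m ∣ 1 + p ^ (2 * j + 1) := by
  have := (h.pow (2 * j + 1)).symm.dvd
  rw [Odd.neg_one_pow ⟨j, rfl⟩] at this
  simpa [add_comm] using this

theorem dvd_of_pow_factorization_succ_dvd_mul {ℓ N M : ℕ} (hℓ : ℓ.Prime) (hN : N ≠ 0)
    (h : ℓ ^ (N.factorization ℓ + 1) ∣ N * M) : ℓ ∣ M := by
  have hNM : N * M = ℓ ^ N.factorization ℓ * (N / ℓ ^ N.factorization ℓ * M) := by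
    rw [← mul_assoc, Nat.ordProj_mul_ordCompl_eq_self]
  rw [hNM, pow_succ] at h
  exact (hℓ.dvd_mul.1 (Nat.dvd_of_mul_dvd_mul_left (pow_pos hℓ.pos _) h)).resolve_left
    (Nat.not_dvd_ordCompl hℓ hN)

end

/-- let `a ∈ {2,3,4,5}` and `ℓ ∈ {2,3,5,7}`, and let `v = ord_ℓ(N_a)`.
If `p` is a prime with `p ≡ -1 (mod ℓ^(v+1))`, then for every positive integer `n`
not divisible by `p`, `MO (a; pn) ≡ 0 (mod ℓ)`. -/
theorem MO_p_congruence_small_ell (a : ℕ) (ha : a ∈ ({2, 3, 4, 5} : Finset ℕ))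
    (ℓ : ℕ) (hℓ : ℓ ∈ ({2, 3, 5, 7} : Finset ℕ))
    (p : ℕ) (hp : p.Prime)
    (hpc : (p : ℤ) ≡ -1 [ZMOD ((ℓ : ℤ) ^ ((Nlevel a).factorization ℓ + 1))])
    (n : ℕ) (hn : 0 < n) (hpn : ¬ p ∣ n) :
    ℓ ∣ MO a (p * n) := by
  have hprime : ℓ.Prime := by
    simp only [mem_insert, mem_singleton] at hℓ
    rcases hℓ with rfl | rfl | rfl | rfl <;> norm_num
  have hN : Nlevel a ≠ 0 := by
    simp only [mem_insert, mem_singleton] at ha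
    rcases ha with rfl | rfl | rfl | rfl <;> norm_num [Nlevel]
  refine dvd_of_pow_factorization_succ_dvd_mul hprime hN ?_
  obtain ⟨P, hP⟩ := exists_Nlevel_mul_MO ha
  zify
  rw [hP]
  refine dvd_sum fun j _ => ?_
  rw [sum_divisors_prime_mul_pow hp hpn]
  exact ((dvd_one_add_pow_odd hpc j).mul_right _).mul_left _
end

section
/- For every non-negative integer n, c_3(17n + 15) ≡ 0 (mod 17). -/
open Finset

/-- `c3 n` is the number of 3-colored partitions of `n`, i.e. the `n`-th coefficient of
the formal power series `∏_{j ≥ 1} (1 - q^j)^{-3}`; in particular `c3 0 = 1`. -/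
def c3 (n : ℕ) : ℕ :=
  ∑ x ∈ (Finset.range (n+1) ×ˢ Finset.range (n+1) ×ˢ Finset.range (n+1)).filter
      (fun x : ℕ × ℕ × ℕ => x.1 + x.2.1 + x.2.2 = n),
    Fintype.card (Nat.Partition x.1) * Fintype.card (Nat.Partition x.2.1) *
      Fintype.card (Nat.Partition x.2.2)

section

open ArithmeticFunction

/-- The number of occurrences of `a` among the parts of all partitions of `n`. -/
def totalCount (n a : ℕ) : ℕ :=
  ∑ p : n.Partition, p.parts.count a

lemma totalCount_of_lt {n a : ℕ} (h : n < a) : totalCount n a = 0 :=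
  Finset.sum_eq_zero fun p _ ↦ Multiset.count_eq_zero.mpr fun ha ↦
    (p.le_of_mem_parts ha).not_gt h

lemma totalCount_eq_add {n a : ℕ} (ha : 1 ≤ a) (han : a ≤ n) :
    totalCount n a = totalCount (n - a) a + Fintype.card (n - a).Partition := by
  have h : totalCount n a =
      ∑ p : {p : n.Partition // a ∈ p.parts}, p.1.parts.count a := by
    rw [totalCount, ← Finset.sum_filter_of_ne (p := fun p : n.Partition ↦ a ∈ p.parts)
      fun p _ hp ↦ Multiset.count_ne_zero.mp hp]
    exact Finset.sum_subtype _ (by simp) _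
  rw [h, ← (Nat.Partition.partitionWithPartEquiv ha han).symm.sum_comp]
  simp [Nat.Partition.partitionWithPartEquiv_symm_apply_parts, totalCount, Finset.sum_add_distrib]

lemma totalCount_eq_sum {a : ℕ} (ha : 1 ≤ a) (n : ℕ) :
    totalCount n a = ∑ p ∈ antidiagonal n,
      if a ∈ p.1.divisors then Fintype.card p.2.Partition else 0 := by
  rw [Finset.Nat.sum_antidiagonal_eq_sum_range_succ_mk]
  induction n using Nat.strong_induction_on with
  | _ n ih =>
    by_cases han : a ≤ n
    · rw [totalCount_eq_add ha han, ih (n - a) (by omega)]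
      obtain ⟨b, rfl⟩ := Nat.exists_eq_add_of_le han
      have hlt : ∀ i ∈ range a, a ∉ i.divisors := fun i hi h ↦
        (Nat.divisor_le h).not_gt (Finset.mem_range.mp hi)
      rw [show (a + b).succ = a + (b + 1) from rfl, Finset.sum_range_add,
        Finset.sum_eq_zero fun i hi ↦ if_neg (hlt i hi), zero_add,
        add_tsub_cancel_left, Finset.sum_range_succ', Finset.sum_range_succ']
      have ha0 : a ≠ 0 := by omega
      simp [ha0, Nat.add_sub_add_left]
    · rw [totalCount_of_lt (by omega)]
      refine (Finset.sum_eq_zero fun i hi ↦ if_neg fun h ↦ ?_).symm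
      have := Nat.divisor_le h
      simp at hi
      omega

/-- Counting the sum of all parts of all partitions of `n` in two ways. -/
lemma mul_card_partition_eq_sum_sigma (n : ℕ) :
    n * Fintype.card n.Partition =
      ∑ p ∈ antidiagonal n, sigma 1 p.1 * Fintype.card p.2.Partition := by
  have h (p : n.Partition) : ∑ a ∈ Icc 1 n, p.parts.count a * a = n := by
    conv_rhs => rw [← p.parts_sum]
    rw [Finset.sum_multiset_count_of_subset _ (Icc 1 n)]
    · simp
    · intro a ha
      rw [Multiset.mem_toFinset] at ha
      exact Finset.mem_Icc.mpr ⟨p.parts_pos ha, p.le_of_mem_parts ha⟩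
  have h2 : n * Fintype.card n.Partition = ∑ a ∈ Icc 1 n, totalCount n a * a := by
    simp_rw [totalCount, Finset.sum_mul]
    rw [Finset.sum_comm]
    simp_rw [h]
    simp [mul_comm]
  rw [h2]
  calc _ = ∑ a ∈ Icc 1 n, ∑ p ∈ antidiagonal n,
      if a ∈ p.1.divisors then a * Fintype.card p.2.Partition else 0 := by
        refine Finset.sum_congr rfl fun a ha ↦ ?_
        rw [totalCount_eq_sum (Finset.mem_Icc.mp ha).1, Finset.sum_mul]
        simp [mul_comm]
    _ = _ := by
        rw [Finset.sum_comm]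
        refine Finset.sum_congr rfl fun p hp ↦ ?_
        rw [← Finset.sum_filter, sigma_one_apply, Finset.sum_mul]
        refine Finset.sum_congr ?_ fun _ _ ↦ rfl
        ext a
        have := Finset.HasAntidiagonal.mem_antidiagonal.mp hp
        simp only [Finset.mem_filter, Finset.mem_Icc, and_iff_right_iff_imp]
        intro h
        have := Nat.divisor_le h
        have := Nat.pos_of_mem_divisors h
        omega

end

section

open PowerSeries ArithmeticFunction

noncomputable section

/-- The Euler operator `X * d/dX` on formal power series. -/
def euler (R : Type*) [CommRing R] : Derivation R R⟦X⟧ R⟦X⟧ :=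
  (X : R⟦X⟧) • derivative R

lemma coeff_euler {R : Type*} [CommRing R] (f : R⟦X⟧) (n : ℕ) :
    coeff n (euler R f) = n * coeff n f := by
  cases n with
  | zero => simp [euler]
  | succ n =>
    simp [euler, coeff_succ_X_mul, coeff_derivative, mul_comm]

lemma map_euler {R S : Type*} [CommRing R] [CommRing S] (φ : R →+* S) (f : R⟦X⟧) :
    (euler R f).map φ = euler S (f.map φ) := by
  ext n
  simp [coeff_euler]

/-- The formal series `1 + a * ∑ σ_k(n) X ^ n`. -/
def eisensteinPowerSeries (R : Type*) [CommRing R] (a : R) (k : ℕ) : R⟦X⟧ :=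
  .mk fun n ↦ if n = 0 then 1 else a * (sigma k n : R)

lemma map_eisensteinPowerSeries {R S : Type*} [CommRing R] [CommRing S] (φ : R →+* S)
    (a : R) (k : ℕ) :
    (eisensteinPowerSeries R a k).map φ = eisensteinPowerSeries S (φ a) k := by
  ext n
  simp [eisensteinPowerSeries, apply_ite φ]

/-- The generating function of the partition numbers. -/
def partitionSeries (R : Type*) [CommRing R] : R⟦X⟧ :=
  .mk fun n ↦ (Fintype.card n.Partition : R)

lemma map_partitionSeries {R S : Type*} [CommRing R] [CommRing S] (φ : R →+* S) :
    (partitionSeries R).map φ = partitionSeries S := by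
  ext n
  simp [partitionSeries]

/-- `c3 n` is the `n`-th coefficient of the cube of the partition generating function. -/
lemma coeff_partitionSeries_pow_three (R : Type*) [CommRing R] (n : ℕ) :
    coeff n (partitionSeries R ^ 3) = (c3 n : R) := by
  have hc : c3 n = ∑ p ∈ antidiagonal n, ∑ r ∈ antidiagonal p.2,
      Fintype.card p.1.Partition * (Fintype.card r.1.Partition * Fintype.card r.2.Partition) := by
    rw [c3, Finset.sum_sigma']
    refine Finset.sum_bij' (fun x _ ↦ ⟨(x.1, x.2.1 + x.2.2), x.2⟩)
      (fun y _ ↦ (y.1.1, y.2)) ?_ ?_ ?_ ?_ ?_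
    · intro x hx
      simp at hx ⊢
      omega
    · rintro ⟨⟨a, b⟩, c, d⟩ hx
      simp at hx ⊢
      omega
    · simp
    · rintro ⟨⟨a, b⟩, c, d⟩ hx
      simp at hx ⊢
      omega
    · intro x _
      simp [mul_assoc]
  rw [hc, pow_succ', pow_two, coeff_mul]
  simp [coeff_mul, partitionSeries, Finset.mul_sum]

/-- Ramanujan's differential system, satisfied by the series `P`, `Q`, `R`. -/
structure RamanujanSystem {A : Type*} [CommRing A] (P Q R : A⟦X⟧) : Prop where
  first : 12 * euler A P = P ^ 2 - Q
  second : 3 * euler A Q = P * Q - R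
  third : 2 * euler A R = P * R - Q ^ 2

lemma RamanujanSystem.map {A B : Type*} [CommRing A] [CommRing B] (φ : A →+* B) {P Q R : A⟦X⟧}
    (h : RamanujanSystem P Q R) :
    RamanujanSystem (P.map φ) (Q.map φ) (R.map φ) := by
  constructor
  · simpa [map_euler, map_ofNat (PowerSeries.map φ)] using congrArg (PowerSeries.map φ) h.first
  · simpa [map_euler, map_ofNat (PowerSeries.map φ)] using congrArg (PowerSeries.map φ) h.second
  · simpa [map_euler, map_ofNat (PowerSeries.map φ)] using congrArg (PowerSeries.map φ) h.third

lemma RamanujanSystem.of_map {A B : Type*} [CommRing A] [CommRing B] (φ : A →+* B)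
    (hφ : Function.Injective φ) {P Q R : A⟦X⟧}
    (h : RamanujanSystem (P.map φ) (Q.map φ) (R.map φ)) : RamanujanSystem P Q R := by
  have hinj := PowerSeries.map_injective φ hφ
  constructor <;> apply hinj
  · simpa [map_euler, map_ofNat (PowerSeries.map φ)] using h.first
  · simpa [map_euler, map_ofNat (PowerSeries.map φ)] using h.second
  · simpa [map_euler, map_ofNat (PowerSeries.map φ)] using h.third

/-- Modulo `17`, the square of `Q ^ 3 - R ^ 2` lies in the image of the Euler operator. -/
lemma RamanujanSystem.exists_euler_eq {A : Type*} [CommRing A] [CharP A 17]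
    {P Q R : A⟦X⟧} (h : RamanujanSystem P Q R) :
    ∃ F, euler A F = (Q ^ 3 - R ^ 2) ^ 2 := by
  have h17 : (17 : A⟦X⟧) = 0 := by
    have : (17 : A) = 0 := by exact_mod_cast CharP.cast_eq_zero A 17
    rw [← map_ofNat (C (R := A)) 17, this, _root_.map_zero]
  have hP : euler A P = 10 * (P ^ 2 - Q) := by
    linear_combination 10 * h.first - 7 * euler A P * h17
  have hQ : euler A Q = 6 * (P * Q - R) := by
    linear_combination 6 * h.second - euler A Q * h17
  have hR : euler A R = 9 * (P * R - Q ^ 2) := by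
    linear_combination 9 * h.third - euler A R * h17
  refine ⟨14 * (Q * R ^ 3) + 11 * (Q ^ 4 * R) + 4 * (P * Q ^ 2 * R ^ 2) + 7 * (P * Q ^ 5) +
    2 * (P ^ 2 * R ^ 3) + 10 * (P ^ 2 * Q ^ 3 * R) + 10 * (P ^ 3 * Q * R ^ 2) +
    12 * (P ^ 3 * Q ^ 4) + 6 * (P ^ 4 * Q ^ 2 * R) + 8 * (P ^ 5 * R ^ 2) + P ^ 5 * Q ^ 3, ?_⟩
  have hn (n : ℕ) [n.AtLeastTwo] : euler A (OfNat.ofNat n) = 0 :=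
    (euler A).map_natCast n
  simp only [map_add, Derivation.leibniz, Derivation.leibniz_pow, hP, hQ, hR, smul_eq_mul,
    nsmul_eq_mul, hn]
  push_cast
  linear_combination ((-5) * R ^ 4 + (-40) * Q ^ 3 * R ^ 2 + (-10) * Q ^ 6 + 22 * P * Q * R ^ 3 +
    (-7) * P * Q ^ 4 * R + (-22) * P ^ 2 * Q ^ 2 * R ^ 2 +
    (-10) * P ^ 2 * Q ^ 5 + 2 * P ^ 3 * R ^ 3 + (-14) * P ^ 3 * Q ^ 3 * R +
    4 * P ^ 4 * Q * R ^ 2 + 32 * P ^ 4 * Q ^ 4 + 12 * P ^ 5 * Q ^ 2 * R +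
    32 * P ^ 6 * R ^ 2 + 4 * P ^ 6 * Q ^ 3) * h17

lemma euler_partitionSeries (R : Type*) [CommRing R] :
    24 * euler R (partitionSeries R) =
      (1 - eisensteinPowerSeries R (-24) 1) * partitionSeries R := by
  have h1 : (1 : R⟦X⟧) - eisensteinPowerSeries R (-24) 1 = 24 * .mk fun n ↦ (sigma 1 n : R) := by
    ext n
    rw [← map_ofNat (C (R := R)) 24, coeff_C_mul]
    by_cases hn : n = 0 <;> simp [eisensteinPowerSeries, coeff_one, hn]
  rw [h1, mul_assoc]
  congr 1
  ext n
  rw [coeff_euler, coeff_mul]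
  simpa [partitionSeries] using congrArg (Nat.cast (R := R)) (mul_card_partition_eq_sum_sigma n)

/-- A formal version of `E₄ ^ 3 - E₆ ^ 2 = 1728 * Δ`. -/
lemma RamanujanSystem.partitionSeries_pow_mul
    (h : RamanujanSystem (eisensteinPowerSeries ℤ (-24) 1) (eisensteinPowerSeries ℤ 240 3)
      (eisensteinPowerSeries ℤ (-504) 5)) :
    partitionSeries ℤ ^ 24 *
      (eisensteinPowerSeries ℤ 240 3 ^ 3 - eisensteinPowerSeries ℤ (-504) 5 ^ 2) = 1728 * X := by
  have hZ := euler_partitionSeries ℤ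
  set P := eisensteinPowerSeries ℤ (-24) 1
  set Q := eisensteinPowerSeries ℤ 240 3 with hQ
  set R := eisensteinPowerSeries ℤ (-504) 5 with hR
  set Z := partitionSeries ℤ with hZdef
  have hW : euler ℤ (Z ^ 24 * (Q ^ 3 - R ^ 2)) = Z ^ 24 * (Q ^ 3 - R ^ 2) := by
    simp only [map_sub, Derivation.leibniz, Derivation.leibniz_pow, smul_eq_mul, nsmul_eq_mul]
    push_cast
    linear_combination Z ^ 23 * (Q ^ 3 - R ^ 2) * hZ + Z ^ 24 * Q ^ 2 * h.second -
      Z ^ 24 * R * h.third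
  have hcoeff (n : ℕ) (hn : n ≠ 1) : coeff n (Z ^ 24 * (Q ^ 3 - R ^ 2)) = 0 := by
    have := congrArg (coeff n) hW
    rw [coeff_euler] at this
    have h2 : ((n : ℤ) - 1) * coeff n (Z ^ 24 * (Q ^ 3 - R ^ 2)) = 0 := by
      linear_combination this
    exact (mul_eq_zero.mp h2).resolve_left (by omega)
  have h1 : coeff 1 (Z ^ 24 * (Q ^ 3 - R ^ 2)) = 1728 := by
    have hQ0 : constantCoeff Q = 1 := by simp [hQ, eisensteinPowerSeries]
    have hR0 : constantCoeff R = 1 := by simp [hR, eisensteinPowerSeries]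
    have hZ0 : constantCoeff Z = 1 := by simp [hZdef, partitionSeries]
    have hQ1 : coeff 1 Q = 240 := by simp [hQ, eisensteinPowerSeries]
    have hR1 : coeff 1 R = -504 := by simp [hR, eisensteinPowerSeries]
    simp [coeff_one_mul, coeff_one_pow, hQ0, hR0, hZ0, hQ1, hR1]
  ext n
  rw [← map_ofNat (C (R := ℤ)) 1728, coeff_C_mul, coeff_X]
  split_ifs with hn
  · rw [hn, h1, mul_one]
  · rw [hcoeff n hn, mul_zero]

end

end

section

open PowerSeries ArithmeticFunction
open UpperHalfPlane ModularForm Derivative Function EisensteinSeries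
open scoped Manifold MatrixGroups Topology

/-- The function `f` on the upper half plane is the sum of the power series `c` in
`q = exp (2 * π * I * τ)`. -/
def HasQExpansion (c : ℂ⟦X⟧) (f : ℍ → ℂ) : Prop :=
  ∀ τ : ℍ, HasSum (fun m ↦ coeff m c • Periodic.qParam 1 τ ^ m) (f τ)

namespace HasQExpansion

variable {b c : ℂ⟦X⟧} {f g : ℍ → ℂ}

lemma sub (hf : HasQExpansion b f) (hg : HasQExpansion c g) :
    HasQExpansion (b - c) (f - g) := fun τ ↦ by
  simpa [sub_mul] using (hf τ).sub (hg τ)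

lemma const_smul (a : ℂ) (hf : HasQExpansion b f) : HasQExpansion (a • b) (a • f) := fun τ ↦ by
  simpa [mul_assoc] using (hf τ).mul_left a

lemma mul (hf : HasQExpansion b f) (hg : HasQExpansion c g) :
    HasQExpansion (b * c) (f * g) := fun τ ↦ by
  have hb := (hf τ).summable.norm
  have hc := (hg τ).summable.norm
  convert! (summable_norm_sum_mul_antidiagonal_of_summable_norm hb hc).of_norm.hasSum using 1
  · ext m
    rw [coeff_mul, Finset.sum_smul]
    refine Finset.sum_congr rfl fun p hp ↦ ?_
    rw [← HasAntidiagonal.mem_antidiagonal.mp hp, pow_add]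
    simp only [smul_eq_mul]
    ring
  · rw [← tsum_mul_tsum_eq_tsum_sum_antidiagonal_of_summable_norm hb hc, (hf τ).tsum_eq,
      (hg τ).tsum_eq, Pi.mul_apply]

lemma summable (hf : HasQExpansion b f) {q : ℂ} (hq : ‖q‖ < 1) :
    Summable fun m ↦ coeff m b * q ^ m := by
  rcases eq_or_ne q 0 with rfl | hq0
  · exact summable_of_ne_finset_zero (s := {0}) fun m hm ↦ by simp_all
  · simpa [Periodic.qParam_right_inv one_ne_zero hq0] using
      (hf ⟨Periodic.invQParam 1 q, Periodic.im_invQParam_pos_of_norm_lt_one one_pos hq hq0⟩).summable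

lemma hasFPowerSeriesOnBall (hf : HasQExpansion b f) :
    HasFPowerSeriesOnBall (fun q ↦ ∑' m, coeff m b * q ^ m) (.ofScalars ℂ fun m ↦ coeff m b)
      0 1 where
  r_le := by
    refine le_of_forall_lt_imp_le_of_dense fun r hr ↦ ?_
    lift r to NNReal using hr.ne_top
    refine FormalMultilinearSeries.le_radius_of_summable _ ?_
    simpa using (hf.summable (q := r) (by simpa using hr)).norm
  r_pos := one_pos
  hasSum {q} hq := by
    rw [← ENNReal.coe_one, Metric.eball_coe, NNReal.coe_one, mem_ball_zero_iff] at hq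
    simpa [mul_comm] using (hf.summable hq).hasSum

lemma comp_ofComplex_eventuallyEq (hf : HasQExpansion b f) (τ : ℍ) :
    f ∘ ofComplex =ᶠ[𝓝 (τ : ℂ)] (fun q ↦ ∑' m, coeff m b * q ^ m) ∘ Periodic.qParam 1 := by
  filter_upwards [isOpen_upperHalfPlaneSet.mem_nhds τ.im_pos] with w hw
  simpa [ofComplex_apply_of_im_pos hw] using (hf ⟨w, hw⟩).tsum_eq.symm

lemma qParam_mem_eball (τ : ℍ) : Periodic.qParam 1 (τ : ℂ) ∈ Metric.eball (0 : ℂ) 1 := by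
  rw [← ENNReal.coe_one, Metric.eball_coe, NNReal.coe_one, mem_ball_zero_iff]
  exact Periodic.norm_qParam_lt_one one_pos τ.im_pos

lemma mdifferentiable (hf : HasQExpansion b f) : MDiff f := fun τ ↦
  mdifferentiableAt_iff.mpr <| ((hf.hasFPowerSeriesOnBall.analyticAt_of_mem
    (qParam_mem_eball τ)).differentiableAt.comp _ (Periodic.differentiable_qParam _)
      ).congr_of_eventuallyEq (hf.comp_ofComplex_eventuallyEq τ)

lemma normalizedDerivOfComplex (hf : HasQExpansion b f) :
    HasQExpansion (euler ℂ b) (normalizedDerivOfComplex f) := fun τ ↦ by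
  have hF := hf.hasFPowerSeriesOnBall
  have heq := hf.comp_ofComplex_eventuallyEq τ
  have hball := qParam_mem_eball τ
  set q := Periodic.qParam 1 (τ : ℂ) with hq
  generalize (fun q ↦ ∑' m, coeff m b * q ^ m) = F at hF heq
  have hsum : HasSum (fun n : ℕ ↦ ((n : ℂ) + 1) * coeff (n + 1) b * q ^ n) (deriv F q) := by
    have := (hF.fderiv.hasSum hball).mapL (ContinuousLinearMap.apply ℂ ℂ (1 : ℂ))
    simpa [mul_comm, mul_left_comm] using this
  have hFq : HasDerivAt F (deriv F q) q :=
    (hF.analyticAt_of_mem hball).differentiableAt.hasDerivAt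
  have hqParam : HasDerivAt (Periodic.qParam 1) (2 * Real.pi * Complex.I * q) (τ : ℂ) := by
    have h : Periodic.qParam 1 = fun z ↦ Complex.exp (2 * Real.pi * Complex.I * z) := by
      ext
      simp [Periodic.qParam]
    simpa [hq, h, mul_comm] using
      ((hasDerivAt_id (τ : ℂ)).const_mul (2 * Real.pi * Complex.I)).cexp
  have hD : Derivative.normalizedDerivOfComplex f τ = q * deriv F q := by
    rw [Derivative.normalizedDerivOfComplex,
      ((hFq.comp (τ : ℂ) hqParam).congr_of_eventuallyEq heq).deriv]
    have := Complex.two_pi_I_ne_zero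
    field_simp
  rw [hD, ← hasSum_nat_add_iff' 1]
  simpa [coeff_euler, pow_succ, mul_comm, mul_left_comm, mul_assoc] using hsum.mul_left q

/-- A level one modular form of weight less than `12` whose constant coefficient vanishes
is zero. -/
lemma eq_zero (hb : HasQExpansion b f) {k : ℤ} (hk : k < 12)
    (hinv : ∀ γ : SL(2, ℤ), f ∣[k] γ = f) (h0 : coeff 0 b = 0) : b = 0 := by
  let F : ModularForm 𝒮ℒ k :=
    { toFun := f
      slash_action_eq' := fun A hA ↦ by
        obtain ⟨A, rfl⟩ := hA
        exact hinv A
      holo' := hb.mdifferentiable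
      bdd_at_cusps' := fun {_} hc ↦ by
        rw [Subgroup.IsArithmetic.isCusp_iff_isCusp_SL2Z] at hc
        rw [OnePoint.isBoundedAt_iff_forall_SL2Z hc]
        intro γ _
        rw [hinv]
        exact isBoundedAtImInfty_of_hasSum_qExpansion one_pos hb }
  have hF (m : ℕ) : coeff m b = (qExpansion 1 F).coeff m :=
    ModularFormClass.qExpansion_coeff_unique one_pos one_mem_strictPeriods_SL (f := F) hb m
  have hzero : F = 0 := by
    refine ModularForm.sturm_bound_levelOne ?_
    rw [Nat.div_eq_of_lt (by omega), Nat.cast_zero, pos_iff_ne_zero,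
      order_ne_zero_iff_constCoeff_eq_zero, ← coeff_zero_eq_constantCoeff_apply, ← hF, h0]
  ext m
  simp [hF, hzero, qExpansion_zero]

lemma euler_eq {d : ℂ⟦X⟧} {h : ℍ → ℂ} {a : ℂ} (hf : HasQExpansion b f) (hg : HasQExpansion c g)
    (hh : HasQExpansion d h) {k : ℤ} (hk : k < 12)
    (hinv : ∀ γ : SL(2, ℤ), (Derivative.normalizedDerivOfComplex f - a • (g - h)) ∣[k] γ =
      Derivative.normalizedDerivOfComplex f - a • (g - h))
    (h0 : coeff 0 c = coeff 0 d) : euler ℂ b = a • (c - d) :=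
  sub_eq_zero.mp <| (hf.normalizedDerivOfComplex.sub ((hg.sub hh).const_smul a)).eq_zero hk hinv <|
    by rw [_root_.map_sub, coeff_euler, PowerSeries.coeff_smul, _root_.map_sub, h0]; simp

end HasQExpansion

lemma hasQExpansion_E2 : HasQExpansion (eisensteinPowerSeries ℂ (-24) 1) E2 := fun τ ↦ by
  simpa [eisensteinPowerSeries, Periodic.qParam] using hasSum_qExpansion_E2 (z := τ)

lemma ModularForm.hasQExpansion {k : ℤ} (f : ModularForm 𝒮ℒ k) :
    HasQExpansion (qExpansion 1 f) f :=
  fun τ ↦ by simpa using ModularForm.hasSum_qExpansion (f := f) one_pos one_mem_strictPeriods_SL τ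

lemma hasQExpansion_E₄ : HasQExpansion (eisensteinPowerSeries ℂ 240 3) E₄ := by
  convert ModularForm.hasQExpansion E₄ using 1
  ext m
  norm_num [eisensteinPowerSeries, E_qExpansion_coeff _ ⟨2, rfl⟩,
    show bernoulli 4 = -1 / 30 by decide +kernel]

lemma hasQExpansion_E₆ : HasQExpansion (eisensteinPowerSeries ℂ (-504) 5) E₆ := by
  convert ModularForm.hasQExpansion E₆ using 1
  ext m
  norm_num [eisensteinPowerSeries, E_qExpansion_coeff _ ⟨3, rfl⟩,
    show bernoulli 6 = 1 / 42 by decide +kernel]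

lemma ModularForm.slash_SL2Z {k : ℤ} (f : ModularForm 𝒮ℒ k) (γ : SL(2, ℤ)) :
    (f : ℍ → ℂ) ∣[k] γ = f :=
  f.slash_action_eq' _ ⟨γ, rfl⟩

/-- The function `12 * D E2 - E2 ^ 2` is invariant of weight `4`. -/
lemma normalizedDerivOfComplex_E2_sub_slash (γ : SL(2, ℤ)) :
    (normalizedDerivOfComplex E2 - (12⁻¹ : ℂ) • (E2 * E2)) ∣[(4 : ℤ)] γ =
      normalizedDerivOfComplex E2 - (12⁻¹ : ℂ) • (E2 * E2) := by
  have hE2 (z : ℍ) : (E2 ∣[(2 : ℤ)] γ) z =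
      E2 z + 12 * (2 * Real.pi * Complex.I)⁻¹ * (γ 1 0 / denom γ z) := by
    have := Complex.I_sq
    simp [E2_slash_action, D2, riemannZeta_two]
    field_simp
    grind
  have hD (z : ℍ) : normalizedDerivOfComplex (E2 ∣[(2 : ℤ)] γ) z =
      normalizedDerivOfComplex E2 z -
        12 * ((2 * Real.pi * Complex.I)⁻¹ * (γ 1 0 / denom γ z)) ^ 2 := by
    have h1 : HasDerivAt (E2 ∘ ofComplex) (deriv (E2 ∘ ofComplex) z) z :=
      (mdifferentiableAt_iff.mp (E2_mdifferentiable z)).hasDerivAt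
    have h2 := (hasDerivAt_denom_zpow (γ : GL (Fin 2) ℝ) (-1) z).const_mul
      (12 * (2 * Real.pi * Complex.I)⁻¹ * (γ 1 0 : ℂ))
    have heq : (E2 ∣[(2 : ℤ)] γ) ∘ ofComplex =ᶠ[𝓝 (z : ℂ)] fun w ↦ (E2 ∘ ofComplex) w +
        12 * (2 * Real.pi * Complex.I)⁻¹ * (γ 1 0 : ℂ) * denom γ w ^ (-1 : ℤ) := by
      filter_upwards [isOpen_upperHalfPlaneSet.mem_nhds z.im_pos] with w hw
      simp [ofComplex_apply_of_im_pos hw, hE2, div_eq_mul_inv, mul_assoc]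
    rw [normalizedDerivOfComplex, ((h1.add h2).congr_of_eventuallyEq heq).deriv,
      normalizedDerivOfComplex]
    simp
    ring
  ext z
  have h1 := congrFun (normalizedDerivOfComplex_SL_slash (k := 2) E2_mdifferentiable (γ := γ)) z
  have h2 := congrFun (mul_slash_SL2 2 2 γ E2 E2) z
  rw [sub_eq_add_neg, SlashAction.add_slash, SlashAction.neg_slash, SL_smul_slash]
  simp [hE2, hD] at h1 h2 ⊢
  norm_num at h1 h2
  linear_combination -h1 - 12⁻¹ * h2

theorem ramanujanSystem_complex :
    RamanujanSystem (eisensteinPowerSeries ℂ (-24) 1) (eisensteinPowerSeries ℂ 240 3)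
      (eisensteinPowerSeries ℂ (-504) 5) := by
  have h1 := hasQExpansion_E2.euler_eq (a := 12⁻¹) (k := 4) (hasQExpansion_E2.mul hasQExpansion_E2)
    hasQExpansion_E₄ (by norm_num) (fun γ ↦ by
      have h := normalizedDerivOfComplex_E2_sub_slash γ
      rw [smul_sub, ← sub_add, SlashAction.add_slash, h, SL_smul_slash, E₄.slash_SL2Z])
    (by simp [eisensteinPowerSeries])
  have h2 := hasQExpansion_E₄.euler_eq (a := 3⁻¹) (k := 6) (hasQExpansion_E2.mul hasQExpansion_E₄)
    hasQExpansion_E₆ (by norm_num) (fun γ ↦ by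
      have h := serreDerivative_slash_invariant hasQExpansion_E₄.mdifferentiable (E₄.slash_SL2Z γ)
      have h' : normalizedDerivOfComplex E₄ - (3⁻¹ : ℂ) • (E2 * E₄ - E₆) =
          serreDerivative (4 : ℤ) E₄ + (3⁻¹ : ℂ) • E₆ := by
        ext z
        simp
        ring
      rw [h', SlashAction.add_slash, SL_smul_slash, E₆.slash_SL2Z]
      exact congrArg (· + _) h)
    (by simp [eisensteinPowerSeries])
  have h3 := hasQExpansion_E₆.euler_eq (a := 2⁻¹) (k := 8) (hasQExpansion_E2.mul hasQExpansion_E₆)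
    (hasQExpansion_E₄.mul hasQExpansion_E₄) (by norm_num) (fun γ ↦ by
      have h := serreDerivative_slash_invariant hasQExpansion_E₆.mdifferentiable (E₆.slash_SL2Z γ)
      have h' : normalizedDerivOfComplex E₆ - (2⁻¹ : ℂ) • (E2 * E₆ - E₄ * E₄) =
          serreDerivative (6 : ℤ) E₆ + (2⁻¹ : ℂ) • (E₄ * E₄) := by
        ext z
        simp
        ring
      have h4 := mul_slash_SL2 4 4 γ E₄ E₄
      rw [E₄.slash_SL2Z] at h4
      rw [h', SlashAction.add_slash, SL_smul_slash]
      exact congrArg₂ (· + ·) h (congrArg _ h4))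
    (by simp [eisensteinPowerSeries])
  rw [smul_eq_C_mul] at h1 h2 h3
  have hC (n : ℂ) (hn : n ≠ 0) : C n * C n⁻¹ = (1 : ℂ⟦X⟧) := by
    rw [← _root_.map_mul, mul_inv_cancel₀ hn, _root_.map_one]
  have h12 := hC 12 (by norm_num)
  have h3' := hC 3 (by norm_num)
  have h2' := hC 2 (by norm_num)
  rw [map_ofNat] at h12 h3' h2'
  constructor
  · rw [h1, ← mul_assoc, h12]
    ring
  · rw [h2, ← mul_assoc, h3', one_mul]
  · rw [h3, ← mul_assoc, h2']
    ring

/-- Ramanujan's differential equations for the Eisenstein series `E₂`, `E₄`, `E₆`. -/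
theorem ramanujanSystem_int :
    RamanujanSystem (eisensteinPowerSeries ℤ (-24) 1) (eisensteinPowerSeries ℤ 240 3)
      (eisensteinPowerSeries ℤ (-504) 5) := by
  refine RamanujanSystem.of_map (Int.castRingHom ℂ) Int.cast_injective ?_
  simpa [map_eisensteinPowerSeries] using ramanujanSystem_complex

/-- Modulo `17`, the cube of the partition generating function is, up to a shift and a nonzero
constant, in the image of the Euler operator. -/
theorem exists_euler_eq_partitionSeries_pow_three :
    ∃ F : (ZMod 17)⟦X⟧, euler _ F =
      C (1728 ^ 2 : ZMod 17) * (X ^ 2 * partitionSeries (ZMod 17) ^ 3) := by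
  let φ := Int.castRingHom (ZMod 17)
  obtain ⟨F, hF⟩ := (ramanujanSystem_int.map φ).exists_euler_eq
  have hΔ := congrArg (PowerSeries.map φ) ramanujanSystem_int.partitionSeries_pow_mul
  simp only [map_mul, map_pow, map_sub, map_partitionSeries, map_ofNat, map_X] at hΔ
  have h17 : (51 : (ZMod 17)⟦X⟧) = 0 := by
    rw [← map_ofNat (C (R := ZMod 17)) 51, show (OfNat.ofNat 51 : ZMod 17) = 0 from rfl,
      _root_.map_zero]
  refine ⟨partitionSeries (ZMod 17) ^ 51 * F, ?_⟩
  simp only [Derivation.leibniz, Derivation.leibniz_pow, smul_eq_mul, nsmul_eq_mul, hF]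
  push_cast
  rw [h17, map_pow, map_ofNat]
  linear_combination partitionSeries (ZMod 17) ^ 3 * (partitionSeries (ZMod 17) ^ 24 *
    (PowerSeries.map φ (eisensteinPowerSeries ℤ 240 3) ^ 3 -
      PowerSeries.map φ (eisensteinPowerSeries ℤ (-504) 5) ^ 2) + 1728 * X) * hΔ

end

/-- for every non-negative integer `n`, `c3 (17n + 15) ≡ 0 (mod 17)`. -/
theorem c3_mod_seventeen (n : ℕ) : 17 ∣ c3 (17 * n + 15) := by
  have h1728 : (1728 ^ 2 : ZMod 17) ≠ 0 := by decide
  have : Fact (Nat.Prime 17) := ⟨by norm_num⟩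
  obtain ⟨F, hF⟩ := exists_euler_eq_partitionSeries_pow_three
  have hc := congrArg (PowerSeries.coeff (17 * n + 15 + 2)) hF
  rw [coeff_euler, PowerSeries.coeff_C_mul, PowerSeries.coeff_X_pow_mul,
    coeff_partitionSeries_pow_three] at hc
  have h0 : ((17 * n + 15 + 2 : ℕ) : ZMod 17) = 0 := by
    rw [ZMod.natCast_eq_zero_iff]
    omega
  rw [h0, zero_mul, eq_comm, mul_eq_zero] at hc
  exact (ZMod.natCast_eq_zero_iff _ _).mp (hc.resolve_left h1728)
end
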